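/- arXiv:0906.4883 — 3 statements merged into one kernel-verified Lean document; each statement's English description precedes it below -/
import Mathlib

section
/- Let 1 ≤ p < ∞. A subset F of L^p(ℝ^n) is totally bounded if and only if: (i) F is bounded in L^p norm; (ii) for every ε > 0 there exists R > 0 such that ∫_{|x|>R} |f(x)|^p dx < ε^p for all f ∈ F; and (iii) for every ε > 0 there exists ρ > 0 such that ∫_{ℝ^n} |f(x+y) − f(x)|^p dx < ε^p for all f ∈ F and all y ∈ ℝ^n with |y| < ρ. -/
open MeasureTheory
open scoped ENNReal

theorem kr_tb {V : Type*} [NormedAddCommGroup V] [NormedSpace ℝ V] (F : Set V) (M : ℝ)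
    (hM : ∀ f ∈ F, ‖f‖ ≤ M)
    (h : ∀ ε > (0:ℝ), ∃ W : Submodule ℝ V, FiniteDimensional ℝ W ∧
      ∀ f ∈ F, ∃ w ∈ W, ‖f - w‖ ≤ ε) : TotallyBounded F := by
  rw [Metric.totallyBounded_iff]
  intro ε hε
  obtain ⟨W, hW, hF⟩ := h (ε/3) (by positivity)
  have hc : IsCompact (Subtype.val '' (Metric.closedBall (0:W) (M + ε/3))) :=
    (isCompact_closedBall _ _).image continuous_subtype_val
  obtain ⟨t, ht, hcov⟩ := Metric.totallyBounded_iff.1 hc.totallyBounded (ε/3) (by positivity)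
  refine ⟨t, ht, fun f hf => ?_⟩
  obtain ⟨w, hw, hfw⟩ := hF f hf
  have h1 : ‖w‖ ≤ M + ε/3 := by
    have := norm_sub_norm_le w f
    rw [norm_sub_rev] at this
    linarith [hM f hf]
  have h2 : w ∈ Subtype.val '' (Metric.closedBall (0:W) (M + ε/3)) :=
    ⟨⟨w, hw⟩, by simpa [mem_closedBall_zero_iff] using h1, rfl⟩
  have h3 := hcov h2
  simp only [Set.mem_iUnion, Metric.mem_ball, exists_prop] at h3 ⊢
  obtain ⟨y, hy, hwy⟩ := h3
  refine ⟨y, hy, ?_⟩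
  have := dist_triangle f w y
  rw [dist_eq_norm f w] at this
  linarith

theorem kr_iff {X : Type*} [MeasurableSpace X] {μ : Measure X} {p : ℝ≥0∞} (hp1 : 1 ≤ p)
    (hp : p ≠ ∞) {g : X → ℝ} (hg : MemLp g p μ) {ε : ℝ} (hε : 0 < ε) :
    ∫ x, |g x| ^ p.toReal ∂μ < ε ^ p.toReal ↔ eLpNorm g p μ < ENNReal.ofReal ε := by
  have hp0 : p ≠ 0 := (zero_lt_one.trans_le hp1).ne'
  have hpp : 0 < p.toReal := ENNReal.toReal_pos hp0 hp
  rw [hg.eLpNorm_eq_integral_rpow_norm hp0 hp, ENNReal.ofReal_lt_ofReal_iff hε]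
  have h0 : 0 ≤ ∫ x, ‖g x‖ ^ p.toReal ∂μ := integral_nonneg fun x => by positivity
  rw [← Real.rpow_lt_rpow_iff (Real.rpow_nonneg h0 _) hε.le hpp,
    ← Real.rpow_mul h0, inv_mul_cancel₀ hpp.ne', Real.rpow_one]
  rfl

/-- Jensen. -/
theorem kr_jensen {X : Type*} [MeasurableSpace X] {μ : Measure X} {p : ℝ≥0∞} (hp1 : 1 ≤ p)
    (hp : p ≠ ∞) {g : X → ℝ} (hg : MemLp g p μ) (B : Set X) (hB0 : μ B ≠ 0) (hB : μ B ≠ ∞)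
    (v : ℝ) :
    ‖v - ⨍ y in B, g y ∂μ‖ₑ ^ p.toReal ≤ (μ B)⁻¹ * ∫⁻ y in B, ‖v - g y‖ₑ ^ p.toReal ∂μ := by
  have hp0 : p ≠ 0 := (zero_lt_one.trans_le hp1).ne'
  have hpp : 0 < p.toReal := ENNReal.toReal_pos hp0 hp
  have hp1' : 1 ≤ p.toReal := by
    simpa using ENNReal.toReal_mono hp hp1
  have : IsFiniteMeasure (μ.restrict B) := ⟨by simpa using hB.lt_top⟩
  have : NeZero (μ.restrict B) := ⟨by simpa using hB0⟩
  set ν := ((μ.restrict B) Set.univ)⁻¹ • μ.restrict B with hν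
  have hνp : IsProbabilityMeasure ν := inferInstance
  have hgB : MemLp g p (μ.restrict B) := hg.restrict B
  have hgi : Integrable g ν := by
    have := (hgB.integrable hp1)
    exact this.smul_measure (by simp [hB0])
  have e1 : (v - ⨍ y in B, g y ∂μ) = ∫ y, (v - g y) ∂ν := by
    rw [integral_sub (integrable_const _) hgi, integral_const, probReal_univ, one_smul]
    rfl
  have e2 : (μ B)⁻¹ * ∫⁻ y in B, ‖v - g y‖ₑ ^ p.toReal ∂μ = ∫⁻ y, ‖v - g y‖ₑ ^ p.toReal ∂ν := by
    rw [hν, lintegral_smul_measure]; simp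
  rw [e1, e2]
  have h1 : ‖∫ y, (v - g y) ∂ν‖ₑ ≤ eLpNorm' (fun y => v - g y) p.toReal ν := by
    refine (enorm_integral_le_lintegral_enorm _).trans ?_
    have := eLpNorm'_le_eLpNorm'_of_exponent_le (f := fun y => v - g y) zero_lt_one hp1' ν
      (aestronglyMeasurable_const.sub hgi.aestronglyMeasurable)
    simpa [eLpNorm'] using this
  calc _ ≤ (eLpNorm' (fun y => v - g y) p.toReal ν) ^ p.toReal := by gcongr
    _ = _ := by
      rw [eLpNorm', ← ENNReal.rpow_mul, one_div, inv_mul_cancel₀ hpp.ne', ENNReal.rpow_one]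

/-- finite valued nearest point map -/
theorem kr_simple {X : Type*} [PseudoMetricSpace X] [Nonempty X] [MeasurableSpace X]
    [BorelSpace X] (K : Set X) (hK : TotallyBounded K) (δ : ℝ) (hδ : 0 < δ) :
    ∃ c : SimpleFunc X X, ∀ x ∈ K, dist x (c x) < δ := by
  obtain ⟨t, ht, hcov⟩ := Metric.totallyBounded_iff.1 hK δ hδ
  induction t, ht using Set.Finite.induction_on generalizing K with
  | empty =>
    refine ⟨SimpleFunc.const X (Classical.arbitrary X), fun x hx => ?_⟩
    simpa using hcov hx
  | @insert a s ha hs ih =>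
    obtain ⟨c, hc⟩ := ih (K \ Metric.ball a δ) (hK.subset Set.sdiff_subset) (by
      intro x hx
      have := hcov hx.1
      simp only [Set.biUnion_insert] at this
      exact this.resolve_left hx.2)
    refine ⟨SimpleFunc.piecewise (Metric.ball a δ) Metric.isOpen_ball.measurableSet
      (SimpleFunc.const X a) c, fun x hx => ?_⟩
    classical
    by_cases hxa : x ∈ Metric.ball a δ
    · rw [SimpleFunc.coe_piecewise, Set.piecewise_eq_of_mem _ _ _ hxa]
      exact hxa
    · rw [SimpleFunc.coe_piecewise, Set.piecewise_eq_of_notMem _ _ _ hxa]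
      exact hc x ⟨hx, hxa⟩

noncomputable def krFun {X : Type*} [MeasurableSpace X] (c : SimpleFunc X X) (K : Set X)
    (a : c.range → ℝ) : X → ℝ := K.indicator fun x => a ⟨c x, c.mem_range_self x⟩

theorem kr_memLp {X : Type*} [MeasurableSpace X] [MeasurableSingletonClass X]
    {μ : Measure X} (p : ℝ≥0∞) (c : SimpleFunc X X)
    (K : Set X) (hK : MeasurableSet K) (hK' : μ K ≠ ∞) (a : c.range → ℝ) :
    MemLp (krFun c K a) p μ := by
  rw [krFun, memLp_indicator_iff_restrict hK]
  have : IsFiniteMeasure (μ.restrict K) := ⟨by simpa using hK'.lt_top⟩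
  have hm : Measurable fun x => a ⟨c x, c.mem_range_self x⟩ :=
    (measurable_of_countable a).comp (c.measurable.subtype_mk)
  refine MemLp.of_bound hm.aestronglyMeasurable ‖a‖ (Filter.Eventually.of_forall fun x => ?_)
  exact norm_le_pi_norm a _

noncomputable def krLin {X : Type*} [MeasurableSpace X] [MeasurableSingletonClass X]
    {μ : Measure X} (p : ℝ≥0∞) [Fact (1 ≤ p)] (c : SimpleFunc X X)
    (K : Set X) (hK : MeasurableSet K) (hK' : μ K ≠ ∞) : (c.range → ℝ) →ₗ[ℝ] Lp ℝ p μ where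
  toFun a := (kr_memLp p c K hK hK' a).toLp _
  map_add' a b := by
    rw [← MemLp.toLp_add]
    apply MemLp.toLp_congr
    refine Filter.Eventually.of_forall fun x => ?_
    by_cases hx : x ∈ K <;> simp [krFun, hx]
  map_smul' r a := by
    rw [RingHom.id_apply, ← MemLp.toLp_const_smul]
    apply MemLp.toLp_congr
    refine Filter.Eventually.of_forall fun x => ?_
    by_cases hx : x ∈ K <;> simp [krFun, hx]

theorem kr_dist {X : Type*} [MeasurableSpace X] {μ : Measure X} (p : ℝ≥0∞) [Fact (1 ≤ p)]
    (hp : p ≠ ∞) (f : Lp ℝ p μ) (g : X → ℝ) (hg : MemLp g p μ) (ε : ℝ) (hε : 0 ≤ ε)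
    (h : ∫⁻ x, ‖f x - g x‖ₑ ^ p.toReal ∂μ ≤ ENNReal.ofReal ε ^ p.toReal) :
    ‖f - hg.toLp g‖ ≤ ε := by
  have hp0 : p ≠ 0 := (zero_lt_one.trans_le (Fact.out : 1 ≤ p)).ne'
  have hpp : 0 < p.toReal := ENNReal.toReal_pos hp0 hp
  rw [Lp.norm_def]
  refine ENNReal.toReal_le_of_le_ofReal hε ?_
  have : (f - hg.toLp g : Lp ℝ p μ) =ᵐ[μ] fun x => f x - g x := by
    filter_upwards [Lp.coeFn_sub f (hg.toLp g), hg.coeFn_toLp] with x h1 h2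
    rw [h1, Pi.sub_apply, h2]
  rw [eLpNorm_congr_ae this, eLpNorm_eq_lintegral_rpow_enorm_toReal hp0 hp, one_div,
    ENNReal.rpow_inv_le_iff hpp]
  exact h

theorem kr_approx (n : ℕ) (p : ℝ≥0∞) [Fact (1 ≤ p)] (hp : p ≠ ∞)
    (R δ : ℝ) (hδ : 0 < δ) :
    ∃ W : Submodule ℝ (Lp ℝ p (volume : Measure (EuclideanSpace ℝ (Fin n)))),
      FiniteDimensional ℝ W ∧
      ∀ (f : Lp ℝ p (volume : Measure (EuclideanSpace ℝ (Fin n)))) (η ε : ℝ), 0 < η → 0 < ε →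
        (2 ^ n + 1) * η ≤ ε →
        (eLpNorm f p (volume.restrict {x | R < ‖x‖}) ≤ ENNReal.ofReal η) →
        (∀ y : EuclideanSpace ℝ (Fin n), ‖y‖ < 2 * δ →
          eLpNorm (fun x => f (x + y) - f x) p volume ≤ ENNReal.ofReal η) →
        ∃ w ∈ W, ‖f - w‖ ≤ ε := by
  have hp1 : 1 ≤ p := Fact.out
  have hp0 : p ≠ 0 := (zero_lt_one.trans_le hp1).ne'
  have hpp : 0 < p.toReal := ENNReal.toReal_pos hp0 hp
  have hp1' : 1 ≤ p.toReal := by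
    simpa using ENNReal.toReal_mono hp hp1
  let E := EuclideanSpace ℝ (Fin n)
  set K : Set E := {x | R < ‖x‖}ᶜ with hKdef
  have hKc : K = Metric.closedBall (0 : E) R := by
    ext x; simp [hKdef]
  have hKm : MeasurableSet K := by rw [hKc]; exact Metric.isClosed_closedBall.measurableSet
  have hKf : volume K ≠ ∞ := by rw [hKc]; exact measure_closedBall_lt_top.ne
  have hKtb : TotallyBounded K := by rw [hKc]; exact (isCompact_closedBall _ _).totallyBounded
  obtain ⟨c, hc⟩ := kr_simple K hKtb δ hδ
  refine ⟨LinearMap.range (krLin p c K hKm hKf), inferInstance, ?_⟩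
  intro f η ε hη hε hηε hf1 hf2
  let a : c.range → ℝ := fun z => ⨍ y in Metric.ball (z : E) δ, f y
  refine ⟨_, LinearMap.mem_range_self _ a, ?_⟩
  refine kr_dist p hp f _ (kr_memLp p c K hKm hKf a) ε hε.le ?_
  have hfm : Measurable f := (Lp.stronglyMeasurable f).measurable
  have hfL : MemLp f p volume := Lp.memLp f
  -- tail
  have hpow : ∀ (ν : Measure E) (g : E → ℝ), eLpNorm g p ν ≤ ENNReal.ofReal η →
      ∫⁻ x, ‖g x‖ₑ ^ p.toReal ∂ν ≤ ENNReal.ofReal η ^ p.toReal := by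
    intro ν g hg
    rwa [eLpNorm_eq_lintegral_rpow_enorm_toReal hp0 hp, one_div,
      ENNReal.rpow_inv_le_iff hpp] at hg
  set H := ENNReal.ofReal η ^ p.toReal with hH
  have tail : ∫⁻ x in Kᶜ, ‖f x - krFun c K a x‖ₑ ^ p.toReal ≤ H := by
    have e : ∫⁻ x in Kᶜ, ‖f x - krFun c K a x‖ₑ ^ p.toReal = ∫⁻ x in Kᶜ, ‖f x‖ₑ ^ p.toReal := by
      refine setLIntegral_congr_fun hKm.compl fun x hx => ?_
      have : x ∉ K := hx
      simp [krFun, this]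
    rw [e, hKdef, compl_compl]
    exact hpow _ _ hf1
  set B := volume (Metric.ball (0 : E) δ) with hB
  have hball : ∀ z : E, volume (Metric.ball z δ) = B := fun z => by
    rw [hB, Measure.addHaar_ball_center]
  have hB0 : B ≠ 0 := (Metric.measure_ball_pos _ _ hδ).ne'
  have hBt : B ≠ ∞ := measure_ball_lt_top.ne
  have pt : ∀ x ∈ K, ‖f x - krFun c K a x‖ₑ ^ p.toReal ≤
      B⁻¹ * ∫⁻ z in Metric.ball (0 : E) (2 * δ), ‖f (x + z) - f x‖ₑ ^ p.toReal := by
    intro x hx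
    have h1 := kr_jensen hp1 hp hfL (Metric.ball (c x) δ) (by rw [hball]; exact hB0)
      (by rw [hball]; exact hBt) (f x)
    have h2 : krFun c K a x = ⨍ y in Metric.ball (c x) δ, f y := by
      simp [krFun, hx, a]
    rw [h2]
    refine h1.trans ?_
    rw [hball]
    refine mul_le_mul_right ?_ _
    rw [← lintegral_indicator Metric.isOpen_ball.measurableSet,
      ← lintegral_indicator Metric.isOpen_ball.measurableSet,
      ← lintegral_add_left_eq_self _ x]
    refine lintegral_mono fun z => ?_
    by_cases hz : x + z ∈ Metric.ball (c x) δ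
    · have hz' : z ∈ Metric.ball (0 : E) (2 * δ) := by
        have h3 := hc x hx
        have h4 := Metric.mem_ball.1 hz
        have h5 := dist_triangle_right (x + z) x (c x)
        rw [mem_ball_zero_iff]
        have h6 : dist (x + z) x = ‖z‖ := by simp
        linarith
      rw [Set.indicator_of_mem hz, Set.indicator_of_mem hz', ← enorm_neg, neg_sub]
    · rw [Set.indicator_of_notMem hz]; exact zero_le
  have main : ∫⁻ x in K, ‖f x - krFun c K a x‖ₑ ^ p.toReal ≤ 2 ^ n * H := by
    calc _ ≤ ∫⁻ x in K, B⁻¹ * ∫⁻ z in Metric.ball (0 : E) (2 * δ),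
              ‖f (x + z) - f x‖ₑ ^ p.toReal := setLIntegral_mono' hKm pt
      _ ≤ ∫⁻ x : E, B⁻¹ * ∫⁻ z in Metric.ball (0 : E) (2 * δ),
              ‖f (x + z) - f x‖ₑ ^ p.toReal := setLIntegral_le_lintegral _ _
      _ = B⁻¹ * ∫⁻ x : E, ∫⁻ z in Metric.ball (0 : E) (2 * δ),
              ‖f (x + z) - f x‖ₑ ^ p.toReal :=
            lintegral_const_mul' _ _ (ENNReal.inv_ne_top.2 hB0)
      _ = B⁻¹ * ∫⁻ z in Metric.ball (0 : E) (2 * δ), ∫⁻ x : E,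
              ‖f (x + z) - f x‖ₑ ^ p.toReal := by
            rw [lintegral_lintegral_swap]
            apply Measurable.aemeasurable
            unfold Function.uncurry
            fun_prop
      _ ≤ B⁻¹ * ∫⁻ z in Metric.ball (0 : E) (2 * δ), H := by
            refine mul_le_mul_right ?_ _
            refine setLIntegral_mono' Metric.isOpen_ball.measurableSet fun z hz => ?_
            exact hpow _ _ (hf2 z (by simpa using hz))
      _ = 2 ^ n * H := by
            rw [setLIntegral_const, Measure.addHaar_ball_mul_of_pos _ _ two_pos, ← hB,
              finrank_euclideanSpace_fin, ENNReal.ofReal_pow (by norm_num), ENNReal.ofReal_ofNat,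
              mul_comm H, ← mul_assoc, mul_left_comm, ENNReal.inv_mul_cancel hB0 hBt, mul_one]
  rw [← lintegral_add_compl _ hKm]
  calc _ ≤ 2 ^ n * H + H := add_le_add main tail
    _ = (2 ^ n + 1) * H := by ring
    _ ≤ (2 ^ n + 1) ^ p.toReal * H := by
      gcongr
      exact ENNReal.le_rpow_self_of_one_le (by simp) hp1'
    _ = (ENNReal.ofReal ((2 ^ n + 1) * η)) ^ p.toReal := by
      rw [hH, ← ENNReal.mul_rpow_of_nonneg _ _ hpp.le, ENNReal.ofReal_mul (by positivity),
        ENNReal.ofReal_add (by positivity) (by positivity), ENNReal.ofReal_pow (by positivity)]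
      simp
    _ ≤ _ := by gcongr

theorem kr_tail (n : ℕ) (p : ℝ≥0∞) [Fact (1 ≤ p)] (hp : p ≠ ∞)
    (f : Lp ℝ p (volume : Measure (EuclideanSpace ℝ (Fin n)))) (ε : ℝ) (hε : 0 < ε) :
    ∃ R > 0, ∀ R' ≥ R, eLpNorm f p (volume.restrict {x | R' < ‖x‖}) ≤ ENNReal.ofReal ε := by
  obtain ⟨g, hgc, hfg, -, -⟩ := (Lp.memLp f).exists_hasCompactSupport_eLpNorm_sub_le hp
    (ε := ENNReal.ofReal ε) (by simpa using hε)
  obtain ⟨R, hR⟩ := hgc.isCompact.isBounded.subset_closedBall 0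
  refine ⟨max R 1, by positivity, fun R' hR' => ?_⟩
  have hm : MeasurableSet {x : EuclideanSpace ℝ (Fin n) | R' < ‖x‖} :=
    measurableSet_lt measurable_const measurable_norm
  refine le_trans (le_of_eq ?_) ((eLpNorm_mono_measure _ (Measure.restrict_le_self (s := {x | R' < ‖x‖}))).trans hfg)
  refine eLpNorm_congr_ae ?_
  filter_upwards [ae_restrict_mem hm] with x hx
  have : g x = 0 := by
    by_contra h
    have h1 := hR (subset_tsupport g h)
    rw [mem_closedBall_zero_iff] at h1
    have h2 : R' < ‖x‖ := hx
    linarith [le_max_left R 1]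
  simp [this]

theorem kr_trans (n : ℕ) (p : ℝ≥0∞) [Fact (1 ≤ p)] (hp : p ≠ ∞)
    (f : Lp ℝ p (volume : Measure (EuclideanSpace ℝ (Fin n)))) (ε : ℝ) (hε : 0 < ε) :
    ∃ ρ > 0, ∀ y : EuclideanSpace ℝ (Fin n), ‖y‖ < ρ →
      eLpNorm (fun x => f (x + y) - f x) p volume ≤ ENNReal.ofReal ε := by
  let E := EuclideanSpace ℝ (Fin n)
  let G : C(E, C(E, E)) := (ContinuousMap.mk (fun a : E × E => a.2 + a.1) (by fun_prop)).curry
  have hG : ∀ y, MeasurePreserving (G y) (volume : Measure E) volume :=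
    fun y => measurePreserving_add_right volume y
  have hcont : Continuous fun y => Lp.compMeasurePreserving (G y) (hG y) f :=
    continuous_const.compMeasurePreservingLp G.continuous hG hp
  obtain ⟨ρ, hρ, h⟩ := Metric.continuous_iff.1 hcont 0 ε hε
  refine ⟨ρ, hρ, fun y hy => ?_⟩
  have h1 := h y (by simpa using hy)
  have h0 : Lp.compMeasurePreserving (G 0) (hG 0) f = f := by
    apply Lp.ext
    filter_upwards [Lp.coeFn_compMeasurePreserving f (hG 0)] with x hx
    rw [hx]
    simp [G]
  rw [h0, dist_eq_norm, Lp.norm_def] at h1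
  have h2 : eLpNorm (Lp.compMeasurePreserving (G y) (hG y) f - f : Lp ℝ p volume) p volume
      = eLpNorm (fun x => f (x + y) - f x) p volume := by
    refine eLpNorm_congr_ae ?_
    filter_upwards [Lp.coeFn_sub (Lp.compMeasurePreserving (G y) (hG y) f) f,
      Lp.coeFn_compMeasurePreserving f (hG y)] with x h3 h4
    rw [h3, Pi.sub_apply, h4]
    simp [G]
  rw [← h2]
  exact (ENNReal.le_ofReal_iff_toReal_le (Lp.eLpNorm_ne_top _) hε.le).2 h1.le

theorem kr_shift_memLp (n : ℕ) (p : ℝ≥0∞)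
    {f : EuclideanSpace ℝ (Fin n) → ℝ} (hf : MemLp f p volume) (y : EuclideanSpace ℝ (Fin n)) :
    MemLp (fun x => f (x + y)) p volume :=
  hf.comp_measurePreserving (measurePreserving_add_right volume y)

theorem kr_shift_norm (n : ℕ) (p : ℝ≥0∞)
    {f : EuclideanSpace ℝ (Fin n) → ℝ} (hf : MemLp f p volume) (y : EuclideanSpace ℝ (Fin n)) :
    eLpNorm (fun x => f (x + y)) p volume = eLpNorm f p volume :=
  eLpNorm_comp_measurePreserving hf.1 (measurePreserving_add_right volume y)

theorem kr_tri {X : Type*} [MeasurableSpace X] {μ : Measure X} {p : ℝ≥0∞} (hp1 : 1 ≤ p)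
    {f h : X → ℝ} (hf : MemLp f p μ) (hh : MemLp h p μ) :
    eLpNorm f p μ ≤ eLpNorm (fun x => f x - h x) p μ + eLpNorm h p μ := by
  have e : f = (fun x => f x - h x) + h := by
    ext x; simp
  calc eLpNorm f p μ = eLpNorm ((fun x => f x - h x) + h) p μ := by rw [← e]
    _ ≤ _ := eLpNorm_add_le (hf.sub hh).1 hh.1 hp1

theorem kr_tri2 (n : ℕ) (p : ℝ≥0∞) (hp1 : 1 ≤ p)
    {f h : EuclideanSpace ℝ (Fin n) → ℝ} (hf : MemLp f p volume) (hh : MemLp h p volume)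
    (y : EuclideanSpace ℝ (Fin n)) :
    eLpNorm (fun x => f (x + y) - f x) p volume ≤
      (eLpNorm (fun x => f x - h x) p volume + eLpNorm (fun x => h (x + y) - h x) p volume)
      + eLpNorm (fun x => f x - h x) p volume := by
  have m1 : MemLp (fun x => f x - h x) p volume := hf.sub hh
  have m2 := kr_shift_memLp n p m1 y
  have m3 : MemLp (fun x => h (x + y) - h x) p volume := (kr_shift_memLp n p hh y).sub hh
  have e : (fun x => f (x + y) - f x) =
      ((fun x => f (x + y) - h (x + y)) + (fun x => h (x + y) - h x))
        - (fun x => f x - h x) := by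
    ext x; simp
  rw [e]
  refine (eLpNorm_sub_le (m2.add m3).1 m1.1 hp1).trans ?_
  refine add_le_add ?_ le_rfl
  refine (eLpNorm_add_le m2.1 m3.1 hp1).trans ?_
  exact add_le_add (kr_shift_norm n p m1 y).le le_rfl

theorem kolmogorov_riesz (n : ℕ) (p : ℝ≥0∞) [Fact (1 ≤ p)] (hp' : p ≠ ∞)
    (F : Set (Lp ℝ p (volume : Measure (EuclideanSpace ℝ (Fin n))))) :
    TotallyBounded F ↔
      ((∃ M : ℝ, ∀ f ∈ F, ‖f‖ ≤ M) ∧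
       (∀ ε > (0 : ℝ), ∃ R > (0 : ℝ), ∀ f ∈ F,
         ∫ x in {x : EuclideanSpace ℝ (Fin n) | R < ‖x‖}, |f x| ^ p.toReal < ε ^ p.toReal) ∧
       (∀ ε > (0 : ℝ), ∃ ρ > (0 : ℝ), ∀ f ∈ F, ∀ y : EuclideanSpace ℝ (Fin n), ‖y‖ < ρ →
         ∫ x : EuclideanSpace ℝ (Fin n), |f (x + y) - f x| ^ p.toReal < ε ^ p.toReal)) := by
  have hp1 : 1 ≤ p := Fact.out
  have key1 : ∀ (f : Lp ℝ p (volume : Measure (EuclideanSpace ℝ (Fin n)))) (R ε : ℝ), 0 < ε →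
      (∫ x in {x : EuclideanSpace ℝ (Fin n) | R < ‖x‖}, |f x| ^ p.toReal < ε ^ p.toReal ↔
        eLpNorm f p (volume.restrict {x | R < ‖x‖}) < ENNReal.ofReal ε) := fun f R ε hε =>
    kr_iff hp1 hp' ((Lp.memLp f).restrict _) hε
  have key2 : ∀ (f : Lp ℝ p (volume : Measure (EuclideanSpace ℝ (Fin n))))
      (y : EuclideanSpace ℝ (Fin n)) (ε : ℝ), 0 < ε →
      (∫ x : EuclideanSpace ℝ (Fin n), |f (x + y) - f x| ^ p.toReal < ε ^ p.toReal ↔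
        eLpNorm (fun x => f (x + y) - f x) p volume < ENNReal.ofReal ε) := fun f y ε hε =>
    kr_iff hp1 hp' ((kr_shift_memLp n p (Lp.memLp f) y).sub (Lp.memLp f)) hε
  constructor
  · intro hF
    have net : ∀ ε > (0:ℝ), ∃ t : Set (Lp ℝ p (volume : Measure (EuclideanSpace ℝ (Fin n)))),
        t.Finite ∧ ∀ f ∈ F, ∃ h ∈ t,
          eLpNorm (fun x => f x - h x) p volume ≤ ENNReal.ofReal ε := by
      intro ε hε
      obtain ⟨t, ht, hcov⟩ := Metric.totallyBounded_iff.1 hF ε hε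
      refine ⟨t, ht, fun f hf => ?_⟩
      have := hcov hf
      simp only [Set.mem_iUnion, Metric.mem_ball, exists_prop] at this
      obtain ⟨h, hh, hd⟩ := this
      refine ⟨h, hh, ?_⟩
      rw [dist_eq_norm, Lp.norm_def] at hd
      have e : eLpNorm (f - h : Lp ℝ p volume) p volume = eLpNorm (fun x => f x - h x) p volume :=
        eLpNorm_congr_ae (Lp.coeFn_sub f h)
      rw [← e]
      exact (ENNReal.le_ofReal_iff_toReal_le (Lp.eLpNorm_ne_top _) hε.le).2 hd.le
    refine ⟨?_, ?_, ?_⟩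
    · exact hF.isBounded.exists_norm_le
    · intro ε hε
      obtain ⟨t, ht, hcov⟩ := net (ε/3) (by positivity)
      choose R hR0 hR using fun h => kr_tail n p hp' h (ε/3) (by positivity)
      obtain ⟨S, hS⟩ := (ht.image R).bddAbove
      refine ⟨max S 1, by positivity, fun f hf => ?_⟩
      rw [key1 f _ ε hε]
      obtain ⟨h, hh, hfh⟩ := hcov f hf
      have h1 := hR h (max S 1) ((hS ⟨h, hh, rfl⟩).trans (le_max_left _ _))
      set ν := (volume : Measure (EuclideanSpace ℝ (Fin n))).restrict {x | max S 1 < ‖x‖} with hν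
      have h2 : eLpNorm (fun x => f x - h x) p ν ≤ ENNReal.ofReal (ε/3) :=
        (eLpNorm_mono_measure _ Measure.restrict_le_self).trans hfh
      calc eLpNorm f p ν ≤ eLpNorm (fun x => f x - h x) p ν + eLpNorm h p ν :=
          kr_tri hp1 ((Lp.memLp f).restrict _) ((Lp.memLp h).restrict _)
        _ ≤ ENNReal.ofReal (ε/3) + ENNReal.ofReal (ε/3) := add_le_add h2 h1
        _ = ENNReal.ofReal (ε/3 + ε/3) := (ENNReal.ofReal_add (by positivity) (by positivity)).symm
        _ < ENNReal.ofReal ε := (ENNReal.ofReal_lt_ofReal_iff hε).2 (by linarith)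
    · intro ε hε
      obtain ⟨t, ht, hcov⟩ := net (ε/4) (by positivity)
      choose r hr0 hr using fun h => kr_trans n p hp' h (ε/4) (by positivity)
      obtain ⟨ρ, hρ0, hρ⟩ : ∃ ρ > (0:ℝ), ∀ h ∈ t, ρ ≤ r h := by
        clear hcov
        induction t, ht using Set.Finite.induction_on with
        | empty => exact ⟨1, one_pos, by simp⟩
        | @insert a s ha hs ih =>
          obtain ⟨ρ, h0, h1⟩ := ih
          refine ⟨min ρ (r a), lt_min h0 (hr0 a), ?_⟩
          intro h hh
          rcases hh with rfl | hh
          · exact min_le_right _ _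
          · exact (min_le_left _ _).trans (h1 h hh)
      refine ⟨ρ, hρ0, fun f hf y hy => ?_⟩
      rw [key2 f y ε hε]
      obtain ⟨h, hh, hfh⟩ := hcov f hf
      have h1 := hr h y (hy.trans_le (hρ h hh))
      calc _ ≤ (eLpNorm (fun x => f x - h x) p volume
              + eLpNorm (fun x => h (x + y) - h x) p volume)
              + eLpNorm (fun x => f x - h x) p volume :=
            kr_tri2 n p hp1 (Lp.memLp f) (Lp.memLp h) y
        _ ≤ (ENNReal.ofReal (ε/4) + ENNReal.ofReal (ε/4)) + ENNReal.ofReal (ε/4) :=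
            add_le_add (add_le_add hfh h1) hfh
        _ = ENNReal.ofReal (ε/4 + ε/4 + ε/4) := by
            rw [← ENNReal.ofReal_add (by positivity) (by positivity),
              ← ENNReal.ofReal_add (by positivity) (by positivity)]
        _ < ENNReal.ofReal ε := (ENNReal.ofReal_lt_ofReal_iff hε).2 (by linarith)
  · rintro ⟨⟨M, hM⟩, h2, h3⟩
    refine kr_tb F M hM fun ε hε => ?_
    have hη : 0 < ε / (2 ^ n + 1) := by positivity
    obtain ⟨R, hR, hF2⟩ := h2 _ hη
    obtain ⟨ρ, hρ, hF3⟩ := h3 _ hη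
    obtain ⟨W, hW, h⟩ := kr_approx n p hp' R (ρ/2) (by positivity)
    refine ⟨W, hW, fun f hf => h f _ ε hη hε (by field_simp; rfl) ?_ ?_⟩
    · exact ((key1 f R _ hη).1 (hF2 f hf)).le
    · intro y hy
      exact ((key2 f y _ hη).1 (hF3 f hf y (by linarith))).le
end

section
/- Let 1 ≤ p < ∞ and let F ⊆ L^p(ℝ^n) satisfy: (i) F is bounded in L^p norm; (ii) for every ε > 0 there exists R such that ∫_{|x|>R} |f(x)|^p dx < ε^p for all f ∈ F; (iii) for every ε > 0 there exists ρ > 0 such that ∫ |f(x+y) − f(x)|^p dx < ε^p for all f ∈ F and all |y| < ρ. Then F is totally bounded in L^p(ℝ^n). -/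
open MeasureTheory
open scoped ENNReal

lemma kr_jensen_s6 {α : Type*} [MeasurableSpace α] (ν : Measure α) [IsProbabilityMeasure ν]
    (f : α → ℝ) (hf : Integrable f ν) (q : ℝ) (hq : 1 ≤ q) (c : ℝ) :
    ‖c - ∫ z, f z ∂ν‖ₑ ^ q ≤ ∫⁻ z, ‖c - f z‖ₑ ^ q ∂ν := by
  have hq0 : 0 < q := by linarith
  have hi : Integrable (fun z => c - f z) ν := (integrable_const c).sub hf
  have e1 : c - ∫ z, f z ∂ν = ∫ z, (c - f z) ∂ν := by
    rw [integral_sub (integrable_const c) hf]; simp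
  have h1 : ‖c - ∫ z, f z ∂ν‖ₑ ≤ eLpNorm (fun z => c - f z) (ENNReal.ofReal q) ν := by
    rw [e1]
    refine (enorm_integral_le_lintegral_enorm _).trans ?_
    rw [← eLpNorm_one_eq_lintegral_enorm]
    exact eLpNorm_le_eLpNorm_of_exponent_le (by simpa using hq) hi.1
  calc _ ≤ _ := ENNReal.rpow_le_rpow h1 hq0.le
    _ = _ := by
      rw [eLpNorm_eq_lintegral_rpow_enorm_toReal (by simpa using hq0) (by simp), ← ENNReal.rpow_mul,
        ENNReal.toReal_ofReal hq0.le]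
      field_simp
      simp

lemma kr_cube {E : Type*} [NormedAddCommGroup E] [MeasurableSpace E] [BorelSpace E]
    [SecondCountableTopology E]
    (μ : Measure E) [μ.IsAddLeftInvariant] [SFinite μ] (f : E → ℝ) (hf : Measurable f) (Q D : Set E)
    (hQ : MeasurableSet Q) (hD : MeasurableSet D) (v : ℝ≥0∞) (hv : μ Q = v) (hv0 : v ≠ 0) (hvt : v ≠ ∞)
    (hQD : ∀ x ∈ Q, ∀ z ∈ Q, z - x ∈ D) (hi : IntegrableOn f Q μ) (q : ℝ) (hq : 1 ≤ q) :
    ∫⁻ x in Q, ‖f x - v.toReal⁻¹ * ∫ z in Q, f z ∂μ‖ₑ ^ q ∂μ ≤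
      ∫⁻ x in Q, v⁻¹ * ∫⁻ y in D, ‖f (x + y) - f x‖ₑ ^ q ∂μ ∂μ := by
  refine setLIntegral_mono' hQ fun x hx => ?_
  have : IsProbabilityMeasure (v⁻¹ • μ.restrict Q) := ⟨by
    simp [hv, ENNReal.inv_mul_cancel hv0 hvt]⟩
  have h := kr_jensen_s6 (v⁻¹ • μ.restrict Q) f (hi.smul_measure (by simpa using hv0)) q hq (f x)
  rw [integral_smul_measure, lintegral_smul_measure, ENNReal.toReal_inv] at h
  refine h.trans ?_
  simp only [smul_eq_mul]
  refine mul_le_mul_right ?_ _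
  rw [← lintegral_indicator hQ, ← lintegral_indicator hD, ← lintegral_add_left_eq_self _ x]
  refine lintegral_mono fun y => ?_
  by_cases hy : x + y ∈ Q
  · have : y ∈ D := by simpa using hQD x hx _ hy
    simp only [Set.indicator_of_mem hy, Set.indicator_of_mem this]
    rw [← enorm_neg, neg_sub]
  · simp [hy]

lemma kr_double {E : Type*} [NormedAddCommGroup E] [MeasurableSpace E] [BorelSpace E]
    [SecondCountableTopology E]
    (μ : Measure E) [SFinite μ] (f : E → ℝ) (hf : Measurable f) (D : Set E)
    (hD : MeasurableSet D) (v e : ℝ≥0∞) (q : ℝ)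
    (h : ∀ y ∈ D, ∫⁻ x, ‖f (x + y) - f x‖ₑ ^ q ∂μ ≤ e) :
    ∫⁻ x, v⁻¹ * ∫⁻ y in D, ‖f (x + y) - f x‖ₑ ^ q ∂μ ∂μ ≤ v⁻¹ * (e * μ D) := by
  have hm : Measurable (Function.uncurry fun x y : E => ‖f (x + y) - f x‖ₑ ^ q) := by
    unfold Function.uncurry; fun_prop
  have hm2 : Measurable fun x => ∫⁻ y in D, ‖f (x + y) - f x‖ₑ ^ q ∂μ :=
    hm.lintegral_prod_right' (ν := μ.restrict D)
  rw [lintegral_const_mul _ hm2]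
  refine mul_le_mul_right ?_ _
  rw [lintegral_lintegral_swap hm.aemeasurable]
  calc _ ≤ ∫⁻ y in D, e ∂μ := setLIntegral_mono' hD h
    _ = _ := by simp

lemma kr_total {E ι : Type*} [NormedAddCommGroup E] [MeasurableSpace E] [BorelSpace E]
    [SecondCountableTopology E]
    (μ : Measure E) [μ.IsAddLeftInvariant] [SFinite μ] (f g : E → ℝ) (hf : Measurable f)
    (K : Finset ι) (Q : ι → Set E) (D : Set E)
    (hQ : ∀ k, MeasurableSet (Q k)) (hD : MeasurableSet D) (v e : ℝ≥0∞) (hv : ∀ k, μ (Q k) = v)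
    (hv0 : v ≠ 0) (hvt : v ≠ ∞) (hdis : Pairwise (Function.onFun Disjoint Q))
    (hQD : ∀ k, ∀ x ∈ Q k, ∀ z ∈ Q k, z - x ∈ D) (hi : ∀ k, IntegrableOn f (Q k) μ)
    (q : ℝ) (hq : 1 ≤ q)
    (h2 : ∫⁻ x in (⋃ k ∈ K, Q k)ᶜ, ‖f x‖ₑ ^ q ∂μ ≤ e)
    (h3 : ∀ y ∈ D, ∫⁻ x, ‖f (x + y) - f x‖ₑ ^ q ∂μ ≤ e)
    (hg0 : ∀ x, (∀ k ∈ K, x ∉ Q k) → g x = 0)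
    (hg : ∀ k ∈ K, ∀ x ∈ Q k, g x = v.toReal⁻¹ * ∫ z in Q k, f z ∂μ) :
    ∫⁻ x, ‖f x - g x‖ₑ ^ q ∂μ ≤ v⁻¹ * (e * μ D) + e := by
  have hU : MeasurableSet (⋃ k ∈ K, Q k) := K.measurableSet_biUnion fun k _ => hQ k
  have hd : Set.PairwiseDisjoint (↑K : Set ι) Q := fun i _ j _ hij => hdis hij
  rw [← lintegral_add_compl _ hU]
  refine add_le_add ?_ ?_
  · rw [lintegral_biUnion_finset hd fun k _ => hQ k]
    calc _ ≤ ∑ k ∈ K, ∫⁻ x in Q k, v⁻¹ * ∫⁻ y in D, ‖f (x + y) - f x‖ₑ ^ q ∂μ ∂μ := by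
          refine Finset.sum_le_sum fun k hk => ?_
          refine le_trans (le_of_eq ?_) (kr_cube μ f hf (Q k) D (hQ k) hD v (hv k) hv0 hvt (hQD k) (hi k) q hq)
          exact setLIntegral_congr_fun (hQ k) fun x hx => by simp only [hg k hk x hx]
      _ = ∫⁻ x in ⋃ k ∈ K, Q k, v⁻¹ * ∫⁻ y in D, ‖f (x + y) - f x‖ₑ ^ q ∂μ ∂μ := by
          rw [lintegral_biUnion_finset hd fun k _ => hQ k]
      _ ≤ _ := setLIntegral_le_lintegral _ _
      _ ≤ _ := kr_double μ f hf D hD v e q h3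
  · refine le_trans (le_of_eq ?_) h2
    refine setLIntegral_congr_fun hU.compl fun x hx => ?_
    have : g x = 0 := hg0 x (by simpa using hx)
    simp [this]

lemma kr_vol (n : ℕ) (s : Fin n → Set ℝ) (hs : ∀ i, MeasurableSet (s i)) :
    MeasurableSet {x : EuclideanSpace ℝ (Fin n) | ∀ i, x i ∈ s i} ∧
    volume {x : EuclideanSpace ℝ (Fin n) | ∀ i, x i ∈ s i} = ∏ i, volume (s i) := by
  have hm : MeasurableSet (Set.univ.pi s) := MeasurableSet.univ_pi hs
  have e : {x : EuclideanSpace ℝ (Fin n) | ∀ i, x i ∈ s i} = 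
    (WithLp.ofLp : EuclideanSpace ℝ (Fin n) → (Fin n → ℝ)) ⁻¹' (Set.univ.pi s) := by
    ext x; simp
  have mp := PiLp.volume_preserving_ofLp (Fin n)
  rw [e]
  refine ⟨mp.measurable hm, ?_⟩
  rw [mp.measure_preimage hm.nullMeasurableSet, volume_pi_pi]

lemma kr_geom (n : ℕ) (ρ R : ℝ) (hρ : 0 < ρ) :
    ∃ (K : Finset (Fin n → ℤ)) (Q : (Fin n → ℤ) → Set (EuclideanSpace ℝ (Fin n)))
      (D : Set (EuclideanSpace ℝ (Fin n))) (v : ℝ≥0∞),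
      (∀ k, MeasurableSet (Q k)) ∧ MeasurableSet D ∧ (∀ k, volume (Q k) = v) ∧ v ≠ 0 ∧ v ≠ ∞ ∧
      (∀ k, ∀ x ∈ Q k, ∀ z ∈ Q k, z - x ∈ D) ∧ Pairwise (Function.onFun Disjoint Q) ∧
      (∀ y ∈ D, ‖y‖ < ρ) ∧ (∀ x, ‖x‖ ≤ R → ∃ k ∈ K, x ∈ Q k) ∧ volume D = 2 ^ n * v := by
  obtain ⟨h, hh0, hh⟩ : ∃ h : ℝ, 0 < h ∧ n * h ^ 2 < ρ ^ 2 := by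
    refine ⟨ρ / (n + 1), by positivity, ?_⟩
    have : (0 : ℝ) < n + 1 := by positivity
    rw [div_pow, mul_div_assoc', div_lt_iff₀ (by positivity)]
    have : (0 : ℝ) ≤ n := by positivity
    have : 0 < ρ ^ 2 := by positivity
    rw [mul_comm]
    exact mul_lt_mul_of_pos_left (by nlinarith) this
  have hQ := fun k : Fin n → ℤ => kr_vol n (fun i => Set.Ico (k i * h) (k i * h + h)) (fun i => measurableSet_Ico)
  have hDD := kr_vol n (fun i => Set.Ioo (-h) h) (fun i => measurableSet_Ioo)
  refine ⟨Fintype.piFinset fun _ => Finset.Icc ⌊-R / h⌋ ⌊R / h⌋,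
    fun k => {x | ∀ i, x i ∈ Set.Ico (k i * h) (k i * h + h)},
    {x | ∀ i, x i ∈ Set.Ioo (-h) h}, ENNReal.ofReal h ^ n, fun k => (hQ k).1, hDD.1, ?_, ?_, ?_,
    ?_, ?_, ?_, ?_, ?_⟩
  · intro k
    rw [(hQ k).2]; simp
  · exact pow_ne_zero _ (by simpa using hh0)
  · simp
  · intro k x hx z hz i
    have h1 := hx i
    have h2 := hz i
    simp only [Set.mem_Ico, Set.mem_Ioo, PiLp.sub_apply] at *
    constructor <;> linarith
  · intro k l hkl
    refine Set.disjoint_left.2 fun x hx hz => hkl ?_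
    funext i
    have key : ∀ m : ℤ, x i ∈ Set.Ico (m * h) (m * h + h) → ⌊x i / h⌋ = m := by
      intro m hm
      rw [Int.floor_eq_iff, le_div_iff₀ hh0, div_lt_iff₀ hh0]
      exact ⟨hm.1, by linarith [hm.2]⟩
    rw [← key _ (hx i), ← key _ (hz i)]
  · intro y hy
    refine lt_of_pow_lt_pow_left₀ 2 hρ.le (lt_of_le_of_lt ?_ hh)
    rw [EuclideanSpace.norm_sq_eq]
    calc _ ≤ ∑ i : Fin n, h ^ 2 := Finset.sum_le_sum fun i _ => by
          have := hy i
          exact pow_le_pow_left₀ (norm_nonneg _) (abs_le.2 ⟨this.1.le, this.2.le⟩) 2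
      _ = _ := by simp
  · intro x hx
    refine ⟨fun i => ⌊x i / h⌋, ?_, fun i => ?_⟩
    · rw [Fintype.mem_piFinset]
      intro i
      have := abs_le.1 ((PiLp.norm_apply_le x i).trans hx)
      rw [Finset.mem_Icc]
      exact ⟨Int.floor_le_floor (by gcongr; exact this.1), Int.floor_le_floor (by gcongr; exact this.2)⟩
    · have h1 := Int.floor_le (x i / h)
      have h2 := Int.lt_floor_add_one (x i / h)
      rw [le_div_iff₀ hh0] at h1
      rw [div_lt_iff₀ hh0] at h2
      exact ⟨h1, by linarith⟩
  · rw [hDD.2]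
    simp [← two_mul, ENNReal.ofReal_mul, mul_pow]

lemma kr_conv {α : Type*} [MeasurableSpace α] (μ : Measure α) (p : ℝ≥0∞) (hp0 : p ≠ 0) (hp : p ≠ ∞) 
    (g : α → ℝ) (hg : MemLp g p μ) (c : ℝ) (h : ∫ x, |g x| ^ p.toReal ∂μ < c) :
    ∫⁻ x, ‖g x‖ₑ ^ p.toReal ∂μ ≤ ENNReal.ofReal c := by
  have hi := hg.integrable_norm_rpow hp0 hp
  have := ofReal_integral_eq_lintegral_ofReal hi (ae_of_all _ fun x => by positivity)
  refine le_trans (le_of_eq ?_) (ENNReal.ofReal_le_ofReal h.le)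
  refine Eq.trans ?_ this.symm
  refine lintegral_congr fun x => ?_
  rw [← ENNReal.ofReal_rpow_of_nonneg (norm_nonneg _) (by positivity), ofReal_norm]

lemma kr_sum {α ι : Type*} [MeasurableSpace α] {μ : Measure α} (p : ℝ≥0∞)
    (K : Finset ι) (f : ι → Lp ℝ p μ) :
    ⇑(∑ k ∈ K, f k) =ᵐ[μ] fun x => ∑ k ∈ K, f k x := by
  classical
  induction K using Finset.induction_on with
  | empty => simp only [Finset.sum_empty]; exact Lp.coeFn_zero ℝ p μ
  | insert a s ha ih =>
    rw [Finset.sum_insert ha]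
    filter_upwards [Lp.coeFn_add (f a) (∑ k ∈ s, f k), ih] with x h1 h2
    rw [h1, Pi.add_apply, h2, Finset.sum_insert ha]

theorem kolmogorov_riesz_sufficiency (n : ℕ) (p : ℝ≥0∞) [Fact (1 ≤ p)] (hp' : p ≠ ∞)
    (F : Set (Lp ℝ p (volume : Measure (EuclideanSpace ℝ (Fin n)))))
    (h1 : ∃ M : ℝ, ∀ f ∈ F, ‖f‖ ≤ M)
    (h2 : ∀ ε > (0 : ℝ), ∃ R : ℝ, ∀ f ∈ F,
      ∫ x in {x : EuclideanSpace ℝ (Fin n) | R < ‖x‖}, |f x| ^ p.toReal < ε ^ p.toReal)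
    (h3 : ∀ ε > (0 : ℝ), ∃ ρ > (0 : ℝ), ∀ f ∈ F, ∀ y : EuclideanSpace ℝ (Fin n), ‖y‖ < ρ →
      ∫ x : EuclideanSpace ℝ (Fin n), |f (x + y) - f x| ^ p.toReal < ε ^ p.toReal) :
    TotallyBounded F := by
  have hp1 : 1 ≤ p := Fact.out
  have hp0 : p ≠ 0 := (zero_lt_one.trans_le hp1).ne'
  have hq1 : 1 ≤ p.toReal := by
    simpa using ENNReal.toReal_mono hp' hp1
  have hq0 : 0 < p.toReal := by linarith
  obtain ⟨M, hM⟩ := h1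
  -- reduction to approximation by a compact set
  suffices H : ∀ η > (0 : ℝ), ∃ S : Set (Lp ℝ p (volume : Measure (EuclideanSpace ℝ (Fin n)))),
      TotallyBounded S ∧ ∀ f ∈ F, ∃ g ∈ S, dist f g ≤ η by
    rw [Metric.totallyBounded_iff]
    intro ε hε
    obtain ⟨S, hS, hFS⟩ := H (ε / 2) (by positivity)
    obtain ⟨t, ht, hSt⟩ := Metric.totallyBounded_iff.1 hS (ε / 2) (by positivity)
    refine ⟨t, ht, fun f hf => ?_⟩
    obtain ⟨g, hg, hfg⟩ := hFS f hf
    obtain ⟨y, hy, hgy⟩ := Set.mem_iUnion₂.1 (hSt hg)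
    refine Set.mem_iUnion₂.2 ⟨y, hy, ?_⟩
    rw [Metric.mem_ball] at *
    linarith [dist_triangle f g y]
  intro η hη
  set C : ℝ := 2 ^ n + 1 with hC
  have hC1 : 1 ≤ C := by rw [hC]; linarith [show (0 : ℝ) < 2 ^ n by positivity]
  obtain ⟨R, hR⟩ := h2 (η / C) (by positivity)
  obtain ⟨ρ, hρ, h3⟩ := h3 (η / C) (by positivity)
  obtain ⟨K, Q, D, v, hQ, hD, hv, hv0, hvt, hQD, hdis, hDρ, hKR, hvD⟩ := kr_geom n ρ R hρ
  have hQt : ∀ k, volume (Q k) ≠ ∞ := fun k => by rw [hv k]; exact hvt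
  let Φ : (K → ℝ) → Lp ℝ p (volume : Measure (EuclideanSpace ℝ (Fin n))) :=
    fun c => ∑ k : K, c k • indicatorConstLp p (hQ k) (hQt k) (1 : ℝ)
  have hΦ : Continuous Φ := by fun_prop
  have hint : ∀ (f : Lp ℝ p (volume : Measure (EuclideanSpace ℝ (Fin n)))) k, 
      IntegrableOn f (Q k) := by
    intro f k
    have : IsFiniteMeasure ((volume : Measure (EuclideanSpace ℝ (Fin n))).restrict (Q k)) :=
      ⟨by simpa using (hQt k).lt_top⟩
    exact ((Lp.memLp f).restrict (Q k)).integrable hp1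
  obtain ⟨B, hB⟩ : ∃ B : ℝ, ∀ f ∈ F, ∀ k, |v.toReal⁻¹ * ∫ z in Q k, f z| ≤ B := by
    refine ⟨v.toReal⁻¹ * (ENNReal.ofReal M * v ^ (1 - 1 / p.toReal)).toReal, fun f hf k => ?_⟩
    rw [abs_mul, abs_of_nonneg (by positivity : 0 ≤ v.toReal⁻¹)]
    refine mul_le_mul_of_nonneg_left ?_ (by positivity)
    have hexp : 0 ≤ 1 - 1 / p.toReal := by
      rw [sub_nonneg, div_le_one hq0]; exact hq1
    have hfin : ENNReal.ofReal M * v ^ (1 - 1 / p.toReal) ≠ ∞ :=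
      ENNReal.mul_ne_top (by simp) (ENNReal.rpow_ne_top_of_nonneg hexp hvt)
    rw [← Real.norm_eq_abs, ← toReal_enorm]
    refine ENNReal.toReal_mono hfin ?_
    refine (enorm_integral_le_lintegral_enorm _).trans ?_
    rw [← eLpNorm_one_eq_lintegral_enorm]
    refine (eLpNorm_le_eLpNorm_mul_rpow_measure_univ hp1 (hint f k).1).trans ?_
    rw [Measure.restrict_apply_univ, hv k, ENNReal.toReal_one, div_one]
    refine mul_le_mul_left ((eLpNorm_restrict_le _ _ _ _).trans ?_) _
    rw [← Lp.enorm_def, ← ofReal_norm]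
    exact ENNReal.ofReal_le_ofReal (hM f hf)
  refine ⟨Φ '' Metric.closedBall 0 (max B 0), 
    ((isCompact_closedBall _ _).image hΦ).totallyBounded, fun f hf => ?_⟩
  let c : K → ℝ := fun k => v.toReal⁻¹ * ∫ z in Q k, f z
  refine ⟨Φ c, ⟨c, ?_, rfl⟩, ?_⟩
  · rw [mem_closedBall_zero_iff, pi_norm_le_iff_of_nonneg (le_max_right _ _)]
    exact fun k => (hB f hf k).trans (le_max_left _ _)
  let g : EuclideanSpace ℝ (Fin n) → ℝ := fun x => ∑ k : K, (Q k).indicator (fun _ => c k) x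
  have hg : ⇑(Φ c) =ᵐ[volume] g := by
    refine (kr_sum p Finset.univ _).trans ?_
    have : ∀ k : K, ⇑(c k • indicatorConstLp p (hQ k) (hQt k) (1 : ℝ)) =ᵐ[volume]
        (Q k).indicator (fun _ => c k) := by
      intro k
      filter_upwards [Lp.coeFn_smul (c k) (indicatorConstLp p (hQ k) (hQt k) (1 : ℝ)),
        indicatorConstLp_coeFn (p := p) (hs := hQ k) (hμs := hQt k) (c := (1 : ℝ))] with x hx hx'
      rw [hx, Pi.smul_apply, hx']
      by_cases hxQ : x ∈ Q k <;> simp [hxQ]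
    filter_upwards [ae_all_iff.2 this] with x hx
    exact Finset.sum_congr rfl fun k _ => hx k
  have hfm : Measurable f := (Lp.stronglyMeasurable f).measurable
  have main := kr_total volume f g hfm K Q D hQ hD v (ENNReal.ofReal ((η / C) ^ p.toReal)) hv hv0 hvt
    hdis hQD (hint f) p.toReal hq1 ?_ ?_ ?_ ?_
  · have hle : eLpNorm (⇑f - ⇑(Φ c)) p volume ≤ ENNReal.ofReal η := by
      rw [eLpNorm_congr_ae (Filter.EventuallyEq.rfl.sub hg), 
        eLpNorm_eq_lintegral_rpow_enorm_toReal hp0 hp', one_div, ENNReal.rpow_inv_le_iff hq0]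
      refine main.trans ?_
      have hvv : v⁻¹ * (ENNReal.ofReal ((η / C) ^ p.toReal) * volume D) = 
          2 ^ n * ENNReal.ofReal ((η / C) ^ p.toReal) := by
        rw [hvD]
        calc _ = (v⁻¹ * v) * (2 ^ n * ENNReal.ofReal ((η / C) ^ p.toReal)) := by ring
          _ = _ := by rw [ENNReal.inv_mul_cancel hv0 hvt, one_mul]
      have hCC : (2 : ℝ≥0∞) ^ n + 1 = ENNReal.ofReal C := by
        rw [hC, ENNReal.ofReal_add (by positivity) (by positivity), ENNReal.ofReal_pow (by positivity)]
        simp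
      rw [hvv, ← add_one_mul, hCC, ← ENNReal.ofReal_mul (by positivity), 
        ENNReal.ofReal_rpow_of_nonneg hη.le hq0.le]
      refine ENNReal.ofReal_le_ofReal ?_
      rw [Real.div_rpow hη.le (by positivity), mul_div_assoc', div_le_iff₀ (by positivity), mul_comm]
      gcongr
      exact Real.self_le_rpow_of_one_le hC1 hq1
    rw [Lp.dist_def]
    exact ENNReal.toReal_le_of_le_ofReal hη.le hle
  · have := kr_conv _ p hp0 hp' f ((Lp.memLp f).restrict _) _ (hR f hf)
    refine le_trans (lintegral_mono_set fun x hx => ?_) this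
    by_contra hx'
    obtain ⟨k, hk, hxk⟩ := hKR x (not_lt.1 hx')
    exact hx (Set.mem_biUnion hk hxk)
  · intro y hy
    refine kr_conv _ p hp0 hp' (fun x => f (x + y) - f x) ?_ _ (h3 f hf y (hDρ y hy))
    exact ((Lp.memLp f).comp_measurePreserving (measurePreserving_add_right volume y)).sub (Lp.memLp f)
  · intro x hx
    exact Finset.sum_eq_zero fun k _ => Set.indicator_of_notMem (hx k k.2) _
  · intro k hk x hx
    refine (Finset.sum_eq_single (⟨k, hk⟩ : K) (fun l _ hl => ?_) (by simp)).trans ?_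
    · refine Set.indicator_of_notMem (fun hxl => ?_) _
      have : (l : Fin n → ℤ) ≠ k := fun h => hl (Subtype.ext h)
      exact Set.disjoint_left.1 (hdis this) hxl hx
    · exact Set.indicator_of_mem hx _
end

section
/- Let F ⊆ L^2(ℝ^d) with sup_{f∈F} ‖f‖_2 ≤ M < ∞. If lim_{r→∞} sup_{f∈F} ∫_{|x|≥r} |f(x)|^2 dx = 0 and lim_{ρ→∞} sup_{f∈F} ∫_{|ξ|≥ρ} |f̂(ξ)|^2 dξ = 0, then F is totally bounded in L^2(ℝ^d). -/
open MeasureTheory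
open scoped ENNReal FourierTransform

/-- Abbreviation for Euclidean space. -/
abbrev PegoE (d : ℕ) := EuclideanSpace ℝ (Fin d)

/-- Abbreviation for the Hilbert space of square integrable functions. -/
noncomputable abbrev PegoH (d : ℕ) := Lp ℂ 2 (volume : Measure (PegoE d))

/-- Cut-off to a measurable set. -/
noncomputable def pegoCut {d : ℕ} {s : Set (PegoE d)} (hs : MeasurableSet s) (f : PegoH d) :
    PegoH d := ((Lp.memLp f).indicator hs).toLp _

theorem pegoCut_coe {d : ℕ} {s : Set (PegoE d)} (hs : MeasurableSet s) (f : PegoH d) :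
    (pegoCut hs f : PegoE d → ℂ) =ᵐ[volume] s.indicator (f : PegoE d → ℂ) :=
  MemLp.coeFn_toLp _

theorem pego_norm_sq {d : ℕ} (f : PegoH d) : ‖f‖ ^ 2 = ∫ x, ‖f x‖ ^ 2 := by
  have h : inner ℂ f f = ((∫ x, ‖f x‖ ^ 2 : ℝ) : ℂ) := by
    rw [L2.inner_def, ← integral_complex_ofReal]
    congr 1
    ext x
    rw [inner_self_eq_norm_sq_to_K]
    push_cast
    rfl
  rw [inner_self_eq_norm_sq_to_K] at h
  exact Complex.ofReal_injective (by push_cast at h ⊢; exact h)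

theorem pegoCut_norm_sq {d : ℕ} {s : Set (PegoE d)} (hs : MeasurableSet s) (f : PegoH d) :
    ‖pegoCut hs f‖ ^ 2 = ∫ x in s, ‖f x‖ ^ 2 := by
  rw [pego_norm_sq, ← integral_indicator hs]
  refine integral_congr_ae ?_
  filter_upwards [pegoCut_coe hs f] with x hx
  rw [hx]
  by_cases h : x ∈ s <;> simp [h]

theorem pegoCut_norm_le {d : ℕ} {s : Set (PegoE d)} (hs : MeasurableSet s) (f : PegoH d) :
    ‖pegoCut hs f‖ ≤ ‖f‖ := by
  refine Lp.norm_le_norm_of_ae_le ?_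
  filter_upwards [pegoCut_coe hs f] with x hx
  rw [hx]
  exact norm_indicator_le_norm_self _ _

theorem pegoCut_sub {d : ℕ} {s : Set (PegoE d)} (hs : MeasurableSet s) (f g : PegoH d) :
    pegoCut hs (f - g) = pegoCut hs f - pegoCut hs g := by
  refine Lp.ext ?_
  filter_upwards [pegoCut_coe hs f, pegoCut_coe hs g, pegoCut_coe hs (f - g),
    Lp.coeFn_sub f g, Lp.coeFn_sub (pegoCut hs f) (pegoCut hs g)] with x h1 h2 h3 h4 h5
  rw [h3, h5, Pi.sub_apply, h1, h2]
  by_cases h : x ∈ s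
  · rw [Set.indicator_of_mem h, Set.indicator_of_mem h, Set.indicator_of_mem h, h4, Pi.sub_apply]
  · simp [h]

theorem pegoCut_add_compl {d : ℕ} {s : Set (PegoE d)} (hs : MeasurableSet s) (f : PegoH d) :
    f = pegoCut hs.compl f + pegoCut hs f := by
  refine Lp.ext ?_
  filter_upwards [pegoCut_coe hs f, pegoCut_coe hs.compl f,
    Lp.coeFn_add (pegoCut hs.compl f) (pegoCut hs f)] with x h1 h2 h3
  rw [h3, Pi.add_apply, h1, h2]
  by_cases h : x ∈ s <;> simp [h]

theorem pegoCut_norm_le_of_bound {d : ℕ} {s : Set (PegoE d)} (hs : MeasurableSet s)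
    (hfin : volume s ≠ ∞) (f : PegoH d) (δ : ℝ) (hδ : 0 ≤ δ)
    (h : ∀ᵐ x, x ∈ s → ‖f x‖ ≤ δ) :
    ‖pegoCut hs f‖ ^ 2 ≤ δ ^ 2 * volume.real s := by
  rw [pegoCut_norm_sq]
  have h' : ∀ᵐ x ∂(volume.restrict s), ‖‖f x‖ ^ 2‖ ≤ δ ^ 2 := by
    rw [ae_restrict_iff' hs]
    filter_upwards [h] with x hx hxs
    rw [Real.norm_of_nonneg (by positivity)]
    exact pow_le_pow_left₀ (norm_nonneg _) (hx hxs) 2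
  have := norm_setIntegral_le_of_norm_le_const_ae (lt_top_iff_ne_top.2 hfin) h'
  exact (le_abs_self _).trans this

theorem pegoCut_integrable {d : ℕ} {s : Set (PegoE d)} (hs : MeasurableSet s)
    (hfin : volume s ≠ ∞) (f : PegoH d) :
    Integrable (pegoCut hs f : PegoE d → ℂ) ∧
      ∫ x, ‖pegoCut hs f x‖ ≤ volume.real s + ‖f‖ ^ 2 := by
  have : IsFiniteMeasure (volume.restrict s) := ⟨by simpa using lt_top_iff_ne_top.2 hfin⟩
  have hI : IntegrableOn (f : PegoE d → ℂ) s :=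
    memLp_one_iff_integrable.1 (((Lp.memLp f).restrict s).mono_exponent (by norm_num))
  have hI2 : IntegrableOn (fun x => ‖f x‖ ^ 2) s :=
    ((memLp_two_iff_integrable_sq_norm (Lp.memLp f).1).1 (Lp.memLp f)).integrableOn
  refine ⟨(integrable_congr (pegoCut_coe hs f)).2 ((integrable_indicator_iff hs).2 hI), ?_⟩
  have e : ∫ x, ‖pegoCut hs f x‖ = ∫ x in s, ‖f x‖ := by
    rw [← integral_indicator hs]
    refine integral_congr_ae ?_
    filter_upwards [pegoCut_coe hs f] with x hx
    rw [hx]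
    by_cases h : x ∈ s <;> simp [h]
  rw [e]
  calc ∫ x in s, ‖f x‖ ≤ ∫ x in s, (1 + ‖f x‖ ^ 2) := by
        refine integral_mono hI.norm ((integrable_const _).add hI2) fun x => ?_
        change ‖f x‖ ≤ 1 + ‖f x‖ ^ 2
        nlinarith [sq_nonneg (‖f x‖ - 1), norm_nonneg (f x)]
    _ = volume.real s + ‖pegoCut hs f‖ ^ 2 := by
        rw [integral_add (integrable_const _) hI2, pegoCut_norm_sq]
        simp
    _ ≤ _ := by
        gcongr
        exact pegoCut_norm_le hs f

theorem pego_fourier_norm_le {d : ℕ} (g : PegoE d → ℂ) (ξ : PegoE d) :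
    ‖𝓕 g ξ‖ ≤ ∫ x, ‖g x‖ :=
  VectorFourier.norm_fourierIntegral_le_integral_norm _ _ _ _ _

theorem pego_exp_sub (a b : ℝ) :
    ‖Complex.exp (a * Complex.I) - Complex.exp (b * Complex.I)‖ ≤ |a - b| := by
  have : Complex.exp (a * Complex.I) - Complex.exp (b * Complex.I) =
      Complex.exp (b * Complex.I) * (Complex.exp (Complex.I * ((a - b : ℝ) : ℂ)) - 1) := by
    rw [mul_sub, ← Complex.exp_add]
    push_cast
    ring_nf
  rw [this, norm_mul, Complex.norm_exp_ofReal_mul_I, one_mul]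
  exact Real.norm_exp_I_mul_ofReal_sub_one_le

theorem pego_fourier_lip {d : ℕ} (g : PegoE d → ℂ) (hg : Integrable g) (r : ℝ)
    (hr : ∀ᵐ x, g x ≠ 0 → ‖x‖ ≤ r) (ξ η : PegoE d) :
    ‖𝓕 g ξ - 𝓕 g η‖ ≤ 2 * Real.pi * r * (∫ x, ‖g x‖) * dist ξ η := by
  have hint : ∀ w : PegoE d, Integrable fun v : PegoE d =>
      Complex.exp (((-2 * Real.pi * inner ℝ v w : ℝ) : ℂ) * Complex.I) • g v := by
    intro w
    refine (integrable_norm_iff ?_).1 ?_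
    · have hc : Continuous fun v : PegoE d =>
          Complex.exp (((-2 * Real.pi * inner ℝ v w : ℝ) : ℂ) * Complex.I) := by fun_prop
      exact hc.aestronglyMeasurable.smul hg.1
    · simpa only [norm_smul, Complex.norm_exp_ofReal_mul_I, one_mul] using hg.norm
  rw [Real.fourier_eq', Real.fourier_eq', ← integral_sub (hint ξ) (hint η)]
  have : 2 * Real.pi * r * (∫ x, ‖g x‖) * dist ξ η =
      ∫ x, 2 * Real.pi * r * dist ξ η * ‖g x‖ := by
    rw [integral_const_mul]; ring
  rw [this]
  refine norm_integral_le_of_norm_le (hg.norm.const_mul _) ?_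
  filter_upwards [hr] with x hx
  rw [← sub_smul, norm_smul]
  by_cases h0 : g x = 0
  · simp [h0]
  refine mul_le_mul_of_nonneg_right ((pego_exp_sub _ _).trans ?_) (norm_nonneg _)
  have e : -2 * Real.pi * inner ℝ x ξ - -2 * Real.pi * inner ℝ x η =
      -(2 * Real.pi * inner ℝ x (ξ - η)) := by rw [inner_sub_right]; ring
  rw [e, abs_neg, abs_mul, abs_of_pos (by positivity : (0 : ℝ) < 2 * Real.pi), dist_eq_norm,
    mul_assoc (2 * Real.pi)]
  refine mul_le_mul_of_nonneg_left ((abs_real_inner_le_norm x (ξ - η)).trans ?_) (by positivity)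
  exact mul_le_mul_of_nonneg_right (hx h0) (norm_nonneg _)

theorem pego_fourier_cont {d : ℕ} (g : PegoE d → ℂ) (hg : Integrable g) : Continuous (𝓕 g) :=
  VectorFourier.fourierIntegral_continuous Real.continuous_fourierChar
    (by exact continuous_inner) hg

theorem pego_cut_set {d : ℕ} (r : ℝ) : MeasurableSet {x : PegoE d | r ≤ ‖x‖}ᶜ :=
  (measurableSet_le measurable_const measurable_norm).compl

theorem pego_cut_fin {d : ℕ} (r : ℝ) : volume ({x : PegoE d | r ≤ ‖x‖}ᶜ) ≠ ∞ := by
  refine ((measure_mono ?_).trans_lt (measure_closedBall_lt_top (x := (0 : PegoE d)) (r := r))).ne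
  intro x hx
  simp only [Set.mem_compl_iff, Set.mem_ofPred_eq, not_le] at hx
  simpa using hx.le

/-- The Fourier transform of the cut-off of `f`, restricted to a compact ball. -/
noncomputable def pegoG {d : ℕ} (r ρ : ℝ) (f : PegoH d) :
    BoundedContinuousFunction (Metric.closedBall (0 : PegoE d) ρ) ℂ :=
  BoundedContinuousFunction.mkOfCompact
    ⟨fun ξ => 𝓕 (pegoCut (pego_cut_set r) f : PegoE d → ℂ) ξ,
      (pego_fourier_cont _ (pegoCut_integrable (pego_cut_set r) (pego_cut_fin r) f).1).comp
        continuous_subtype_val⟩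

theorem pegoG_totallyBounded {d : ℕ} (r ρ M : ℝ) (F : Set (PegoH d)) (hM : ∀ f ∈ F, ‖f‖ ≤ M) :
    TotallyBounded (pegoG r ρ '' F) := by
  set C : ℝ := volume.real ({x : PegoE d | r ≤ ‖x‖}ᶜ) + M ^ 2 with hC
  have hb : ∀ f ∈ F, ∫ x, ‖pegoCut (pego_cut_set r) f x‖ ≤ C := fun f hf =>
    (pegoCut_integrable (pego_cut_set r) (pego_cut_fin r) f).2.trans (by
      rw [hC]; gcongr; exact hM f hf)
  have hc := BoundedContinuousFunction.arzela_ascoli (Metric.closedBall (0 : ℂ) C)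
    (isCompact_closedBall _ _) (pegoG r ρ '' F) ?_ ?_
  · exact hc.totallyBounded.subset subset_closure
  · rintro _ ξ ⟨f, hf, rfl⟩
    rw [mem_closedBall_zero_iff]
    exact (pego_fourier_norm_le _ _).trans (hb f hf)
  · refine Metric.equicontinuous_of_continuity_modulus
      (fun t => 2 * Real.pi * |r| * C * t) ?_ _ ?_
    · have : Continuous fun t : ℝ => 2 * Real.pi * |r| * C * t := by fun_prop
      simpa using this.tendsto 0
    · rintro ξ η ⟨_, f, hf, rfl⟩
      rw [dist_eq_norm]
      refine (pego_fourier_lip _ (pegoCut_integrable (pego_cut_set r) (pego_cut_fin r) f).1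
        |r| ?_ ξ η).trans ?_
      · filter_upwards [pegoCut_coe (pego_cut_set r) f] with x hx hne
        rw [hx] at hne
        have := Set.mem_of_indicator_ne_zero hne
        simp only [Set.mem_compl_iff, Set.mem_ofPred_eq, not_le] at this
        exact this.le.trans (le_abs_self r)
      · rw [Subtype.dist_eq]
        gcongr
        exact hb f hf

theorem pego_compactness (d : ℕ)
    (T : Lp ℂ 2 (volume : Measure (EuclideanSpace ℝ (Fin d))) ≃ₗᵢ[ℂ]
         Lp ℂ 2 (volume : Measure (EuclideanSpace ℝ (Fin d))))
    (hT : ∀ f : Lp ℂ 2 (volume : Measure (EuclideanSpace ℝ (Fin d))),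
      Integrable (f : EuclideanSpace ℝ (Fin d) → ℂ) volume →
      (T f : EuclideanSpace ℝ (Fin d) → ℂ) =ᵐ[volume] 𝓕 (f : EuclideanSpace ℝ (Fin d) → ℂ))
    (F : Set (Lp ℂ 2 (volume : Measure (EuclideanSpace ℝ (Fin d)))))
    (M : ℝ) (hM : ∀ f ∈ F, ‖f‖ ≤ M)
    (h1 : ∀ ε > (0 : ℝ), ∃ r : ℝ, ∀ f ∈ F,
      ∫ x in {x : EuclideanSpace ℝ (Fin d) | r ≤ ‖x‖}, ‖f x‖ ^ 2 < ε)
    (h2 : ∀ ε > (0 : ℝ), ∃ ρ : ℝ, ∀ f ∈ F,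
      ∫ ξ in {ξ : EuclideanSpace ℝ (Fin d) | ρ ≤ ‖ξ‖}, ‖(T f) ξ‖ ^ 2 < ε) :
    TotallyBounded F := by
  classical
  have hcompl : ∀ (a : ℝ) (f : PegoH d) (ε : ℝ), 0 < ε →
      ∫ x in {x : PegoE d | a ≤ ‖x‖}, ‖f x‖ ^ 2 < ε ^ 2 →
      ‖pegoCut (pego_cut_set a).compl f‖ < ε := by
    intro a f ε hε h
    refine lt_of_pow_lt_pow_left₀ 2 hε.le ?_
    rw [pegoCut_norm_sq, compl_compl]
    exact h
  refine Metric.totallyBounded_of_finite_discretization fun ε hε => ?_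
  obtain ⟨r, hr⟩ := h1 ((ε / 8) ^ 2) (by positivity)
  obtain ⟨ρ, hρ⟩ := h2 ((ε / 8) ^ 2) (by positivity)
  set V : ℝ := volume.real ({x : PegoE d | ρ ≤ ‖x‖}ᶜ) with hV
  have hV0 : 0 ≤ V := measureReal_nonneg
  set δ : ℝ := ε / (16 * (V + 1)) with hδ
  have hδ0 : 0 < δ := by positivity
  obtain ⟨t, -, htf, htc⟩ :=
    Metric.finite_approx_of_totallyBounded (pegoG_totallyBounded r ρ M F hM) δ hδ0
  have hex : ∀ f : F, ∃ y : t, dist (pegoG r ρ f.1) y < δ := by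
    intro f
    have := htc (Set.mem_image_of_mem _ f.2)
    simp only [Set.mem_iUnion, Metric.mem_ball, exists_prop] at this
    obtain ⟨y, hy, h⟩ := this
    exact ⟨⟨y, hy⟩, h⟩
  choose N hN using hex
  refine ⟨t, htf.fintype, N, ?_⟩
  intro f g hfg
  have hdG : dist (pegoG r ρ f.1) (pegoG r ρ g.1) < 2 * δ := by
    have h1 := hN f
    have h2 := hN g
    rw [hfg] at h1
    linarith [dist_triangle_right (pegoG r ρ f.1) (pegoG r ρ g.1) (N g)]
  -- the main term
  set u : PegoH d := pegoCut (pego_cut_set r) f.1 with hu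
  set v : PegoH d := pegoCut (pego_cut_set r) g.1 with hv
  have hmain : ‖pegoCut (pego_cut_set ρ) (T u - T v)‖ ≤ ε / 8 := by
    refine le_of_sq_le_sq ?_ (by positivity)
    refine (pegoCut_norm_le_of_bound (pego_cut_set ρ) (pego_cut_fin ρ) (T u - T v) (2 * δ)
      (by positivity) ?_).trans ?_
    · filter_upwards [hT u (pegoCut_integrable (pego_cut_set r) (pego_cut_fin r) f.1).1,
        hT v (pegoCut_integrable (pego_cut_set r) (pego_cut_fin r) g.1).1,
        Lp.coeFn_sub (T u) (T v)] with ξ e1 e2 e3 hξ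
      have hξ' : ξ ∈ Metric.closedBall (0 : PegoE d) ρ := by
        simp only [Set.mem_compl_iff, Set.mem_ofPred_eq, not_le] at hξ
        simpa using hξ.le
      rw [e3, Pi.sub_apply, e1, e2, ← dist_eq_norm]
      exact (BoundedContinuousFunction.dist_coe_le_dist (f := pegoG r ρ f.1)
        (g := pegoG r ρ g.1) ⟨ξ, hξ'⟩).trans hdG.le
    · have e : (2 * δ) * (V + 1) = ε / 8 := by
        rw [hδ]; field_simp; norm_num
      calc (2 * δ) ^ 2 * V ≤ (2 * δ) ^ 2 * (V + 1) ^ 2 := by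
            gcongr; nlinarith
        _ = (ε / 8) ^ 2 := by rw [← mul_pow, e]
  have hsmall : ∀ f ∈ F, ‖T f - pegoCut (pego_cut_set ρ) (T (pegoCut (pego_cut_set r) f))‖
      ≤ ε / 4 := by
    intro f hf
    have e1 : T f - pegoCut (pego_cut_set ρ) (T (pegoCut (pego_cut_set r) f)) =
        pegoCut (pego_cut_set ρ).compl (T f) +
          pegoCut (pego_cut_set ρ) (T (pegoCut (pego_cut_set r).compl f)) := by
      have a := pegoCut_add_compl (pego_cut_set ρ) (T f)
      have b : pegoCut (pego_cut_set r).compl f = f - pegoCut (pego_cut_set r) f :=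
        eq_sub_of_add_eq (pegoCut_add_compl (pego_cut_set r) f).symm
      rw [b, map_sub, pegoCut_sub]
      nth_rewrite 1 [a]
      abel
    rw [e1]
    have b1 := hcompl ρ (T f) (ε / 8) (by positivity) (hρ f hf)
    have b2 := hcompl r f (ε / 8) (by positivity) (hr f hf)
    have b3 := pegoCut_norm_le (pego_cut_set ρ) (T (pegoCut (pego_cut_set r).compl f))
    rw [T.norm_map] at b3
    linarith [norm_add_le (pegoCut (pego_cut_set ρ).compl (T f))
      (pegoCut (pego_cut_set ρ) (T (pegoCut (pego_cut_set r).compl f)))]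
  rw [← T.dist_map, dist_eq_norm]
  have e : T f.1 - T g.1 = (T f.1 - pegoCut (pego_cut_set ρ) (T u)) -
      (T g.1 - pegoCut (pego_cut_set ρ) (T v)) + pegoCut (pego_cut_set ρ) (T u - T v) := by
    rw [pegoCut_sub]; abel
  rw [e]
  have c1 := hsmall f.1 f.2
  have c2 := hsmall g.1 g.2
  have c3 := norm_add_le ((T f.1 - pegoCut (pego_cut_set ρ) (T u)) -
      (T g.1 - pegoCut (pego_cut_set ρ) (T v))) (pegoCut (pego_cut_set ρ) (T u - T v))
  have c4 := norm_sub_le (T f.1 - pegoCut (pego_cut_set ρ) (T u))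
      (T g.1 - pegoCut (pego_cut_set ρ) (T v))
  linarith
end
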